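/- arXiv:2511.03545 — 6 statements merged into one kernel-verified Lean document; each statement's English description precedes it below -/
import Mathlib

section
/- Let U be a finite set of features and let 𝓕 be a family of subsets of U with ∅ ∉ 𝓕. Define the model M : (U → Bool) → Bool by M(e) = true if and only if {u ∈ U : e(u) = true} ∈ 𝓕, and let e₀ be the all-zero example over U. Then a set S ⊆ U is a hitting set for 𝓕 (i.e., S ∩ F' ≠ ∅ for every F' ∈ 𝓕) if and only if S is a local abductive explanation for e₀ w.r.t. M. -/
/-- `A` is a local abductive explanation (lAXp) for example `e` w.r.t. model `M`. -/
def IsLAXp {U : Type*} (M : (U → Bool) → Bool) (e : U → Bool) (A : Set U) : Prop :=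
  ∀ e' : U → Bool, (∀ u ∈ A, e' u = e u) → M e' = M e

theorem stmt3 (U : Type*) [Fintype U] [DecidableEq U]
    (𝓕 : Finset (Finset U)) (hF : ∅ ∉ 𝓕) (S : Finset U) :
    (∀ F' ∈ 𝓕, (S ∩ F').Nonempty) ↔
      IsLAXp (fun e : U → Bool => decide ((Finset.univ.filter fun u => e u = true) ∈ 𝓕))
        (fun _ => false) (↑S : Set U) := by
  have hzero : (Finset.univ.filter fun _ : U => false = true) = ∅ := by simp
  simp only [IsLAXp, hzero, hF, decide_false, decide_eq_false_iff_not, Finset.mem_coe]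
  constructor
  · intro hS e' he' hmem
    obtain ⟨u, hu⟩ := hS _ hmem
    rw [Finset.mem_inter, Finset.mem_filter] at hu
    simp [he' u hu.1] at hu
  · intro hS F' hF'
    by_contra hne
    rw [Finset.not_nonempty_iff_eq_empty, ← Finset.disjoint_iff_inter_eq_empty] at hne
    refine hS (fun u => decide (u ∈ F')) (fun u hu => ?_) (by simpa using hF')
    exact decide_eq_false (Finset.disjoint_left.mp hne hu)
end

section
/- Let U be a finite set of features and let 𝓕 be a family of subsets of U with ∅ ∉ 𝓕. Define the model M : (U → Bool) → Bool by M(e) = true if and only if there exists F' ∈ 𝓕 with F' ⊆ {u ∈ U : e(u) = true}, and let e₀ be the all-zero example over U. Then a set S ⊆ U is a hitting set for 𝓕 (i.e., S ∩ F' ≠ ∅ for every F' ∈ 𝓕) if and only if S is a local abductive explanation for e₀ w.r.t. M. -/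
/-- The model classifying `e` positively iff some member of `𝓕` is contained in the
set of features set to `true` by `e`. -/
def subsetModel {U : Type*} [Fintype U] [DecidableEq U] (𝓕 : Finset (Finset U)) :
    (U → Bool) → Bool :=
  fun e => decide (∃ F' ∈ 𝓕, F' ⊆ Finset.univ.filter fun u => e u = true)

theorem subsetModel_eq_true_iff {U : Type*} [Fintype U] [DecidableEq U]
    {𝓕 : Finset (Finset U)} {e : U → Bool} :
    subsetModel 𝓕 e = true ↔ ∃ F' ∈ 𝓕, ∀ u ∈ F', e u = true := by
  simp [subsetModel, Finset.subset_iff]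

theorem subsetModel_const_false {U : Type*} [Fintype U] [DecidableEq U]
    {𝓕 : Finset (Finset U)} (hF : ∅ ∉ 𝓕) :
    subsetModel 𝓕 (fun _ => false) = false := by
  rw [← Bool.not_eq_true, subsetModel_eq_true_iff]
  rintro ⟨F', hF', h⟩
  exact hF (Finset.eq_empty_of_forall_notMem (fun u hu => Bool.false_ne_true (h u hu)) ▸ hF')

theorem stmt4 (U : Type*) [Fintype U] [DecidableEq U]
    (𝓕 : Finset (Finset U)) (hF : ∅ ∉ 𝓕) (S : Finset U) :
    (∀ F' ∈ 𝓕, (S ∩ F').Nonempty) ↔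
      IsLAXp (subsetModel 𝓕) (fun _ => false) (↑S : Set U) := by
  simp only [IsLAXp, subsetModel_const_false hF, Finset.mem_coe]
  constructor
  · intro hS e he
    rw [← Bool.not_eq_true, subsetModel_eq_true_iff]
    rintro ⟨F', hF', h⟩
    obtain ⟨u, hu⟩ := hS F' hF'
    rw [Finset.mem_inter] at hu
    exact Bool.false_ne_true ((he u hu.1).symm.trans (h u hu.2))
  · intro hS F' hF'
    by_contra hdisj
    rw [Finset.not_nonempty_iff_eq_empty, ← Finset.disjoint_iff_inter_eq_empty] at hdisj
    have hfalse := hS (fun u => decide (u ∈ F'))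
      fun u hu => decide_eq_false (Finset.disjoint_left.mp hdisj hu)
    have htrue : subsetModel 𝓕 (fun u => decide (u ∈ F')) = true :=
      subsetModel_eq_true_iff.mpr ⟨F', hF', fun u hu => decide_eq_true hu⟩
    exact Bool.false_ne_true (hfalse.symm.trans htrue)
end

section
/- Let G be a finite simple graph on vertex set V with n = |V| vertices and m edges, let k ≥ 1, and suppose G admits a proper k-coloring of its vertices. For an example e : V → Bool define P(e) = n · |{ {u,v} : u ≠ v, {u,v} is not an edge of G, and not (e(u) = true and e(v) = true) }| + |{ v ∈ V : e(v) = true }|. Then there exists an example e with P(e) ≥ n·(C(n,2) − m) + k if and only if G contains a clique of size k; moreover, for every example e with P(e) ≥ n·(C(n,2) − m) + k, the set {v ∈ V : e(v) = true} is a clique of G of size exactly k. -/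
/-- The value `P(e)`: `n` times the number of unordered pairs of distinct non-adjacent
vertices that are not both set to `true` by `e`, plus the number of vertices set to
`true` by `e`. -/
noncomputable def Pval {V : Type*} [Fintype V] (G : SimpleGraph V) (e : V → Bool) : ℕ :=
  Fintype.card V *
      Set.ncard {s : Sym2 V | ¬ s.IsDiag ∧ s ∉ G.edgeSet ∧ ¬ ∀ v ∈ s, e v = true} +
    Set.ncard {v : V | e v = true}

theorem ncard_nonedges {V : Type*} [Fintype V] (G : SimpleGraph V) :
    Set.ncard {s : Sym2 V | ¬ s.IsDiag ∧ s ∉ G.edgeSet} =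
      (Fintype.card V).choose 2 - Set.ncard G.edgeSet := by
  classical
  have hdiff : {s : Sym2 V | ¬ s.IsDiag ∧ s ∉ G.edgeSet} =
      {s : Sym2 V | ¬ s.IsDiag} \ G.edgeSet := rfl
  have hsub : G.edgeSet ⊆ {s : Sym2 V | ¬ s.IsDiag} :=
    fun _ hs => G.not_isDiag_of_mem_edgeSet hs
  rw [hdiff, Set.ncard_sdiff hsub (Set.toFinite _), ← Sym2.card_subtype_not_diag,
    ← Nat.card_eq_fintype_card]
  rfl

theorem isClique_true_iff {V : Type*} (G : SimpleGraph V) (e : V → Bool) :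
    G.IsClique {v : V | e v = true} ↔
      {s : Sym2 V | ¬ s.IsDiag ∧ s ∉ G.edgeSet ∧ ¬ ∀ v ∈ s, e v = true} =
        {s : Sym2 V | ¬ s.IsDiag ∧ s ∉ G.edgeSet} := by
  constructor
  · intro h
    ext s
    induction s using Sym2.ind with
    | _ u v =>
      simp only [Set.mem_ofPred_eq, Sym2.mk_isDiag_iff, SimpleGraph.mem_edgeSet]
      refine ⟨fun hs => ⟨hs.1, hs.2.1⟩, fun hs => ⟨hs.1, hs.2, fun ht => hs.2 ?_⟩⟩
      exact h (ht u (Sym2.mem_mk_left u v)) (ht v (Sym2.mem_mk_right u v)) hs.1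
  · intro h u hu v hv huv
    by_contra hadj
    have hmem : s(u, v) ∈ {s : Sym2 V | ¬ s.IsDiag ∧ s ∉ G.edgeSet} := ⟨by simpa, by simpa⟩
    rw [← h] at hmem
    refine hmem.2.2 fun w hw => ?_
    rcases Sym2.mem_iff.mp hw with rfl | rfl
    · exact hu
    · exact hv

theorem Pval_of_isClique {V : Type*} [Fintype V] (G : SimpleGraph V) (e : V → Bool)
    (h : G.IsClique {v : V | e v = true}) :
    Pval G e = Fintype.card V * ((Fintype.card V).choose 2 - Set.ncard G.edgeSet) +
      Set.ncard {v : V | e v = true} := by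
  rw [Pval, (isClique_true_iff G e).mp h, ncard_nonedges]

theorem Pval_le_of_not_isClique {V : Type*} [Fintype V] (G : SimpleGraph V) (e : V → Bool)
    (h : ¬ G.IsClique {v : V | e v = true}) :
    Pval G e ≤ Fintype.card V * ((Fintype.card V).choose 2 - Set.ncard G.edgeSet) := by
  rw [isClique_true_iff] at h
  have hss : {s : Sym2 V | ¬ s.IsDiag ∧ s ∉ G.edgeSet ∧ ¬ ∀ v ∈ s, e v = true} ⊂
      {s : Sym2 V | ¬ s.IsDiag ∧ s ∉ G.edgeSet} :=
    LE.le.ssubset_of_ne (fun _ hs => ⟨hs.1, hs.2.1⟩) h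
  have hlt := Set.ncard_lt_ncard hss (Set.toFinite _)
  have hcard : Set.ncard {v : V | e v = true} ≤ Fintype.card V := by
    rw [← Nat.card_eq_fintype_card]
    exact Set.ncard_le_card _
  rw [Pval, ← ncard_nonedges]
  calc _ ≤ Fintype.card V *
        Set.ncard {s : Sym2 V | ¬ s.IsDiag ∧ s ∉ G.edgeSet ∧ ¬ ∀ v ∈ s, e v = true} +
          Fintype.card V := by gcongr
    _ = Fintype.card V *
        (Set.ncard {s : Sym2 V | ¬ s.IsDiag ∧ s ∉ G.edgeSet ∧ ¬ ∀ v ∈ s, e v = true} + 1) := by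
      ring
    _ ≤ _ := Nat.mul_le_mul_left _ hlt

theorem stmt7 (V : Type*) [Fintype V] [DecidableEq V] (G : SimpleGraph V) (k : ℕ)
    (hk : 1 ≤ k) (hcol : G.Colorable k) :
    ((∃ e : V → Bool,
        Pval G e ≥
          Fintype.card V * ((Fintype.card V).choose 2 - Set.ncard G.edgeSet) + k) ↔
      ∃ s : Finset V, G.IsNClique k s) ∧
    (∀ e : V → Bool,
      Pval G e ≥
          Fintype.card V * ((Fintype.card V).choose 2 - Set.ncard G.edgeSet) + k →
        G.IsClique {v : V | e v = true} ∧ Set.ncard {v : V | e v = true} = k) := by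
  have key : ∀ e : V → Bool,
      Pval G e ≥
          Fintype.card V * ((Fintype.card V).choose 2 - Set.ncard G.edgeSet) + k →
        G.IsClique {v : V | e v = true} ∧ Set.ncard {v : V | e v = true} = k := by
    intro e he
    have hclique : G.IsClique {v : V | e v = true} := by
      by_contra h
      have := Pval_le_of_not_isClique G e h
      omega
    refine ⟨hclique, le_antisymm ?_ ?_⟩
    · rw [Set.ncard_eq_toFinset_card']
      exact SimpleGraph.IsClique.card_le_of_colorable (by simpa using hclique) hcol
    · rw [Pval_of_isClique G e hclique] at he
      omega
  refine ⟨⟨?_, ?_⟩, key⟩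
  · rintro ⟨e, he⟩
    obtain ⟨hclique, hcard⟩ := key e he
    refine ⟨{v : V | e v = true}.toFinset, by simpa using hclique, ?_⟩
    rw [← Set.ncard_eq_toFinset_card', hcard]
  · rintro ⟨s, hs⟩
    have hset : {v : V | decide (v ∈ s) = true} = (s : Set V) := by
      ext v
      simp
    refine ⟨fun v => decide (v ∈ s), ?_⟩
    rw [Pval_of_isClique G _ (by rw [hset]; exact hs.isClique), hset, Set.ncard_coe_finset,
      hs.card_eq]
end

section
/- Let F be a finite set of features equipped with a total order <, and let E be a finite set of examples over F. Then there exists a decision tree T over F that respects <, has exactly |E| leaves labeled true, has at most 2·|E|·|F| + 1 leaves in total, and satisfies: for every example e over F, T(e) = true if and only if e agrees on all of F with some member of E (equivalently, e ∈ E). -/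
/-- A decision tree over feature set `F`: every inner node is labelled by a feature
and has a 0-child and a 1-child; every leaf is labelled by a Boolean. -/
inductive DTree (F : Type*) where
  | leaf : Bool → DTree F
  | node : F → DTree F → DTree F → DTree F

namespace DTree

/-- Classification of an example by a decision tree. -/
def eval {F : Type*} : DTree F → (F → Bool) → Bool
  | leaf b, _ => b
  | node f t0 t1, e => if e f then t1.eval e else t0.eval e

/-- The number of leaves of a decision tree. -/
def numLeaves {F : Type*} : DTree F → ℕ
  | leaf _ => 1
  | node _ t0 t1 => t0.numLeaves + t1.numLeaves

/-- The number of leaves labelled `c`. -/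
def countLeaves {F : Type*} (c : Bool) : DTree F → ℕ
  | leaf b => if b = c then 1 else 0
  | node _ t0 t1 => countLeaves c t0 + countLeaves c t1

/-- The list of features occurring at inner nodes of a decision tree. -/
def features {F : Type*} : DTree F → List F
  | leaf _ => []
  | node f t0 t1 => f :: (t0.features ++ t1.features)

/-- A decision tree respects the order `<` if along every root-to-leaf path the
features occur in strictly increasing order (equivalently, the feature of every inner
node is smaller than all features occurring below it). -/
def Ordered {F : Type*} [LT F] : DTree F → Prop
  | leaf _ => True
  | node f t0 t1 =>
      (∀ g ∈ t0.features, f < g) ∧ (∀ g ∈ t1.features, f < g) ∧ t0.Ordered ∧ t1.Ordered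

end DTree

/-- Any finite set of examples that agree outside a strictly increasing list `L` of features is
recognized, up to agreement on `L`, by an ordered decision tree using only features of `L`. -/
theorem DTree.exists_of_list {F : Type*} [LinearOrder F] (L : List F) (hL : L.Pairwise (· < ·))
    (E : Finset (F → Bool)) (hE : ∀ e ∈ E, ∀ e' ∈ E, ∀ f ∉ L, e f = e' f) :
    ∃ T : DTree F, T.Ordered ∧ (∀ g ∈ T.features, g ∈ L) ∧ T.countLeaves true = E.card ∧
      T.numLeaves ≤ 2 * E.card * L.length + 1 ∧
      ∀ e : F → Bool, T.eval e = true ↔ ∃ e' ∈ E, ∀ f ∈ L, e f = e' f := by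
  induction L generalizing E with
  | nil =>
    rcases E.eq_empty_or_nonempty with rfl | ⟨a, ha⟩
    · exact ⟨leaf false, by simp [Ordered, features, countLeaves, numLeaves, eval]⟩
    · obtain rfl : E = {a} := Finset.eq_singleton_iff_unique_mem.2
        ⟨ha, fun x hx => funext fun f => hE x hx a ha f List.not_mem_nil⟩
      exact ⟨leaf true, by simp [Ordered, features, countLeaves, numLeaves, eval]⟩
  | cons f L ih =>
    rcases E.eq_empty_or_nonempty with rfl | hne
    · exact ⟨leaf false, by simp [Ordered, features, countLeaves, numLeaves, eval]⟩
    obtain ⟨hf, hL⟩ := List.pairwise_cons.1 hL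
    have agree (b : Bool) : ∀ e ∈ E.filter (· f = b), ∀ e' ∈ E.filter (· f = b),
        ∀ g ∉ L, e g = e' g := by
      intro e he e' he' g hg
      rw [Finset.mem_filter] at he he'
      by_cases hgf : g = f
      · rw [hgf, he.2, he'.2]
      · exact hE e he.1 e' he'.1 g (by simp [hgf, hg])
    obtain ⟨T0, ho0, hf0, hc0, hn0, he0⟩ := ih hL _ (agree false)
    obtain ⟨T1, ho1, hf1, hc1, hn1, he1⟩ := ih hL _ (agree true)
    have hcard : (E.filter (· f = false)).card + (E.filter (· f = true)).card = E.card := by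
      rw [add_comm, ← Finset.card_filter_add_card_filter_not (s := E) (· f = true)]
      simp
    refine ⟨node f T0 T1, ⟨fun g hg => hf g (hf0 g hg), fun g hg => hf g (hf1 g hg), ho0, ho1⟩,
      ?_, ?_, ?_, ?_⟩
    · intro g hg
      simp only [features, List.mem_cons, List.mem_append] at hg ⊢
      exact hg.imp_right fun h => h.elim (hf0 g) (hf1 g)
    · rw [countLeaves, hc0, hc1, hcard]
    · have hpos := hne.card_pos
      rw [numLeaves, List.length_cons, ← hcard]
      rw [← hcard] at hpos
      nlinarith
    · intro e
      cases h : e f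
      · simp [eval, h, he0, and_assoc, eq_comm (a := false)]
      · simp [eval, h, he1, and_assoc, eq_comm (a := true)]

theorem stmt9 (F : Type*) [Fintype F] [LinearOrder F] (E : Finset (F → Bool)) :
    ∃ T : DTree F, T.Ordered ∧ T.countLeaves true = E.card ∧
      T.numLeaves ≤ 2 * E.card * Fintype.card F + 1 ∧
      ∀ e : F → Bool, T.eval e = true ↔ e ∈ E := by
  obtain ⟨T, ho, -, hc, hn, he⟩ := DTree.exists_of_list (Finset.univ.sort (α := F) (· ≤ ·))
    (Finset.sortedLT_sort _).pairwise E (by simp)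
  refine ⟨T, ho, hc, by simpa using hn, fun e => ?_⟩
  simp [he, ← funext_iff]
end

section
/- Let F be a finite set of features and let T₁, …, T_ℓ (ℓ ≥ 1) be decision trees over F. Then there exists a decision tree T over F whose number of leaves is at most the product of the numbers of leaves of T₁, …, T_ℓ, such that for every example e over F: T(e) = true if and only if |{ i ∈ {1,…,ℓ} : T_i(e) = true }| ≥ ⌊ℓ/2⌋ + 1 (i.e., T computes the majority classification of the ensemble {T₁, …, T_ℓ}). -/
namespace DTree

/-- Replace every leaf labeled `b` of a decision tree by the tree `k b`. -/
def graft {F : Type*} : DTree F → (Bool → DTree F) → DTree F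
  | leaf b, k => k b
  | node f t0 t1, k => node f (t0.graft k) (t1.graft k)

theorem eval_graft {F : Type*} (t : DTree F) (k : Bool → DTree F) (e : F → Bool) :
    (t.graft k).eval e = (k (t.eval e)).eval e := by
  induction t with
  | leaf b => rfl
  | node f t0 t1 h0 h1 =>
    simp only [graft, eval, h0, h1]
    split <;> rfl

theorem numLeaves_graft_le {F : Type*} (t : DTree F) (k : Bool → DTree F) (m : ℕ)
    (hk : ∀ b, (k b).numLeaves ≤ m) : (t.graft k).numLeaves ≤ t.numLeaves * m := by
  induction t with
  | leaf b => simpa [graft, numLeaves] using hk b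
  | node f t0 t1 h0 h1 =>
    simp only [graft, numLeaves, add_mul]
    exact Nat.add_le_add h0 h1

/-- Every Boolean combination of finitely many decision trees is computed by a decision tree
whose number of leaves is at most the product of theirs. -/
theorem exists_eval_eq_comp {F : Type*} (n : ℕ) (T : Fin n → DTree F)
    (g : (Fin n → Bool) → Bool) :
    ∃ T' : DTree F, T'.numLeaves ≤ ∏ i, (T i).numLeaves ∧
      ∀ e : F → Bool, T'.eval e = g fun i => (T i).eval e := by
  induction n with
  | zero =>
    exact ⟨leaf (g Fin.elim0), by simp [numLeaves],
      fun e => congrArg g (Subsingleton.elim _ _)⟩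
  | succ n ih =>
    choose k hk hke using fun b : Bool => ih (fun i => T i.succ) fun v => g (Fin.cons b v)
    refine ⟨(T 0).graft k, ?_, fun e => ?_⟩
    · rw [Fin.prod_univ_succ]
      exact numLeaves_graft_le _ _ _ hk
    · rw [eval_graft, hke]
      exact congrArg g (Fin.cons_self_tail fun i => (T i).eval e)

end DTree

theorem stmt10 (F : Type*) (ℓ : ℕ) (hℓ : 1 ≤ ℓ) (T : Fin ℓ → DTree F) :
    ∃ T' : DTree F,
      T'.numLeaves ≤ ∏ i : Fin ℓ, (T i).numLeaves ∧
      ∀ e : F → Bool,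
        T'.eval e = true ↔
          (Finset.univ.filter fun i : Fin ℓ => (T i).eval e = true).card ≥ ℓ / 2 + 1 := by
  obtain ⟨T', hT', h⟩ := DTree.exists_eval_eq_comp ℓ T fun v =>
    decide ((Finset.univ.filter fun i => v i = true).card ≥ ℓ / 2 + 1)
  exact ⟨T', hT', fun e => by rw [h, decide_eq_true_iff]⟩
end

section
/- Let a, b be natural numbers, let c ∈ Bool, let 𝓕 be a family of finite sets of features with |𝓕| ≤ b and |F'| ≤ a for every F' ∈ 𝓕, and let < be a total order on the features. Then there exists a decision tree T over a feature set containing ⋃𝓕 such that: T respects <; T has at most b leaves labeled c; T has at most 2ab² + 1 leaves in total; and for every example e defined on a feature set containing ⋃𝓕, T(e) = c if and only if there exists F' ∈ 𝓕 such that for every feature f ∈ ⋃𝓕, e(f) = true ⟺ f ∈ F' (and T(e) = ¬c otherwise). -/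
/-- Trie construction: along a strictly increasing list `L` of features, some ordered decision tree
tests agreement on `L` with a member of `𝓖`. -/
theorem DTree.exists_ordered_of_sorted_list {F : Type*} [LinearOrder F] (c : Bool)
    (L : List F) (hL : L.Pairwise (· < ·)) (𝓖 : Finset (Finset F)) :
    ∃ T : DTree F, T.Ordered ∧ (∀ g ∈ T.features, g ∈ L) ∧ T.countLeaves c ≤ 𝓖.card ∧
      T.numLeaves ≤ L.length * 𝓖.card + 1 ∧
      ∀ e : F → Bool, T.eval e = c ↔ ∃ G ∈ 𝓖, ∀ f ∈ L, (e f = true ↔ f ∈ G) := by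
  induction L generalizing 𝓖 with
  | nil =>
    rcases 𝓖.eq_empty_or_nonempty with rfl | h
    · refine ⟨leaf (!c), ?_⟩
      simp [Ordered, features, countLeaves, numLeaves, eval]
    · refine ⟨leaf c, ?_⟩
      simpa [Ordered, features, countLeaves, numLeaves, eval, Finset.Nonempty] using h
  | cons f L ih =>
    rcases 𝓖.eq_empty_or_nonempty with rfl | h
    · refine ⟨leaf (!c), ?_⟩
      simp [Ordered, features, countLeaves, numLeaves, eval]
    obtain ⟨hf, hL⟩ := List.pairwise_cons.1 hL
    obtain ⟨T₀, o₀, m₀, c₀, n₀, e₀⟩ := ih hL (𝓖.filter (f ∉ ·))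
    obtain ⟨T₁, o₁, m₁, c₁, n₁, e₁⟩ := ih hL (𝓖.filter (f ∈ ·))
    have hcard := Finset.card_filter_add_card_filter_not (s := 𝓖) (f ∈ ·)
    refine ⟨node f T₀ T₁, ⟨fun g hg => hf g (m₀ g hg), fun g hg => hf g (m₁ g hg), o₀, o₁⟩,
      ?_, ?_, ?_, fun e => ?_⟩
    · simp only [features, List.mem_cons, List.mem_append]
      rintro g (rfl | hg | hg)
      · exact Or.inl rfl
      · exact Or.inr (m₀ g hg)
      · exact Or.inr (m₁ g hg)
    · simp only [countLeaves]
      omega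
    · have := h.card_pos
      simp only [numLeaves, List.length_cons]
      rw [← hcard] at this ⊢
      nlinarith
    · simp only [List.forall_mem_cons]
      cases he : e f
      · simp [eval, he, e₀, and_assoc]
      · simp [eval, he, e₁, and_assoc]

theorem stmt14 (F : Type*) [Fintype F] [LinearOrder F]
    (a b : ℕ) (c : Bool) (𝓕 : Finset (Finset F))
    (hb : 𝓕.card ≤ b) (ha : ∀ F' ∈ 𝓕, F'.card ≤ a) :
    ∃ T : DTree F, T.Ordered ∧ T.countLeaves c ≤ b ∧
      T.numLeaves ≤ 2 * a * b ^ 2 + 1 ∧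
      ∀ e : F → Bool,
        T.eval e = c ↔ ∃ F' ∈ 𝓕, ∀ f ∈ 𝓕.sup id, (e f = true ↔ f ∈ F') := by
  obtain ⟨T, hord, -, hcount, hnum, heval⟩ :=
    DTree.exists_ordered_of_sorted_list c ((𝓕.sup id).sort (· ≤ ·))
      (Finset.sortedLT_sort _).pairwise 𝓕
  refine ⟨T, hord, hcount.trans hb, ?_, by simpa only [Finset.mem_sort] using heval⟩
  have hsup : (𝓕.sup id).card ≤ b * a := by
    rw [Finset.sup_eq_biUnion]
    exact (Finset.card_biUnion_le_card_mul _ _ a ha).trans (Nat.mul_le_mul_right a hb)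
  rw [Finset.length_sort] at hnum
  have := Nat.mul_le_mul hsup hb
  nlinarith [Nat.zero_le (a * b ^ 2)]
end
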